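/- Let (A, δ) be a connected differential ring and let Λ be an Azumaya A-algebra equipped with a derivation D : Λ → Λ (additive, satisfying the Leibniz rule) with D(a·1_Λ) = δ(a)·1_Λ for all a ∈ A. Then there exist n ≥ 1, a faithfully flat differential extension (A, δ) → (B, δ_B), and a B-algebra isomorphism ψ : B ⊗_A Λ → Mₙ(B) such that ψ(D̃(t)) = δ_B(ψ(t)) for all t ∈ B ⊗_A Λ, where D̃ is the unique additive map on B ⊗_A Λ with D̃(b ⊗ λ) = δ_B(b) ⊗ λ + b ⊗ D(λ), and δ_B applied to a matrix means entrywise application. -/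

import Mathlib

universe u

open TensorProduct

/-- A faithfully flat differential extension of a differential ring `(A, δ)`:
a commutative `A`-algebra `B` that is faithfully flat as an `A`-module, equipped
with a derivation `δB` extending `δ`. -/
structure FFDiffExt (A : Type u) [CommRing A] (δ : A → A) : Type (u + 1) where
  B : Type u
  [commRing : CommRing B]
  [algebra : Algebra A B]
  δB : B → B
  δB_add : ∀ x y : B, δB (x + y) = δB x + δB y
  δB_mul : ∀ x y : B, δB (x * y) = δB x * y + x * δB y
  compat : ∀ a : A, δB (algebraMap A B a) = algebraMap A B (δ a)
  faithfullyFlat : Module.FaithfullyFlat A B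

attribute [instance] FFDiffExt.commRing FFDiffExt.algebra

/-- The canonical map `Λ ⊗[A] Λᵐᵒᵖ →ₗ[A] End_A(Λ)`, sending `a ⊗ bᵒᵖ` to `x ↦ a * x * b`.
An A-algebra `Λ` (finitely generated, faithful and projective as an A-module) is Azumaya
when this map is bijective. -/
noncomputable def azumayaMulMap (A : Type u) (Λ : Type u) [CommRing A] [Ring Λ] [Algebra A Λ] :
    Λ ⊗[A] Λᵐᵒᵖ →ₗ[A] (Λ →ₗ[A] Λ) :=
  TensorProduct.lift <|
    LinearMap.mk₂ A
      (fun a b => (LinearMap.mulLeft A a).comp (LinearMap.mulRight A b.unop))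
      (fun a a' b => by ext x; simp [add_mul, mul_add])
      (fun c a b => by ext x; simp [smul_mul_assoc])
      (fun a b b' => by ext x; simp [mul_add])
      (fun c a b => by ext x; simp [mul_smul_comm])


section Separability

variable {A Λ : Type u} [CommRing A] [Ring Λ] [Algebra A Λ]

@[simp]
lemma azumayaMulMap_tmul (a : Λ) (b : Λᵐᵒᵖ) (x : Λ) :
    azumayaMulMap A Λ (a ⊗ₜ b) x = a * x * b.unop := by
  simp [azumayaMulMap, mul_assoc]

/-- The unit of a finite projective faithful algebra splits off linearly. -/
lemma exists_linearMap_apply_one_eq_one [Module.Finite A Λ] [Module.Projective A Λ]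
    [FaithfulSMul A Λ] : ∃ t : Λ →ₗ[A] A, t 1 = 1 := by
  let J : Ideal A := LinearMap.range (LinearMap.applyₗ (R := A) (M₂ := A) (1 : Λ))
  suffices hJ : J = ⊤ by
    have : (1 : A) ∈ J := hJ ▸ trivial
    obtain ⟨t, ht⟩ := this
    exact ⟨t, ht⟩
  obtain ⟨m, f, g, -, -, hfg⟩ := Module.Finite.exists_comp_eq_id_of_projective A Λ
  have h1 : (1 : Λ) = ∑ k, g 1 k • f (Pi.single k 1) := by
    conv_lhs => rw [← LinearMap.id_apply (R := A) (1 : Λ), ← hfg, LinearMap.comp_apply,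
      ← (Pi.basisFun A (Fin m)).sum_repr (g 1), map_sum]
    simp
  have htop : (⊤ : Submodule A Λ) ≤ J • (⊤ : Submodule A Λ) := by
    intro x _
    rw [← mul_one x, h1, Finset.mul_sum]
    refine Submodule.sum_mem _ fun k _ ↦ ?_
    rw [mul_smul_comm]
    exact Submodule.smul_mem_smul ⟨LinearMap.proj k ∘ₗ g, rfl⟩ trivial
  obtain ⟨r, hr, hr'⟩ := Submodule.exists_sub_one_mem_and_smul_eq_zero_of_fg_of_le_smul J ⊤
    Module.Finite.fg_top htop
  have : r = 0 := FaithfulSMul.eq_of_smul_eq_smul (α := Λ) fun x ↦ by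
    rw [hr' x trivial, zero_smul]
  rw [Ideal.eq_top_iff_one]
  simpa [this] using J.neg_mem hr

/-- Azumaya algebras have a separability idempotent. -/
lemma exists_separability_element [Module.Finite A Λ] [Module.Projective A Λ]
    [FaithfulSMul A Λ] (hAz : Function.Bijective (azumayaMulMap A Λ)) :
    ∃ e : Λ ⊗[A] Λᵐᵒᵖ, azumayaMulMap A Λ e 1 = 1 ∧
      ∀ x : Λ, (x ⊗ₜ[A] (1 : Λᵐᵒᵖ)) * e = (1 ⊗ₜ MulOpposite.op x) * e := by
  obtain ⟨t, ht⟩ := exists_linearMap_apply_one_eq_one (A := A) (Λ := Λ)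
  obtain ⟨e, he⟩ := hAz.2 (Algebra.linearMap A Λ ∘ₗ t)
  refine ⟨e, by simp [he, ht], fun x ↦ hAz.1 ?_⟩
  ext y
  have h1 : ∀ e : Λ ⊗[A] Λᵐᵒᵖ, azumayaMulMap A Λ ((x ⊗ₜ[A] (1 : Λᵐᵒᵖ)) * e) y =
      x * azumayaMulMap A Λ e y := by
    intro e
    induction e with
    | zero => simp
    | add a b ha hb => simp only [mul_add, map_add, LinearMap.add_apply, ha, hb]
    | tmul a b => simp [mul_assoc]
  have h2 : ∀ e : Λ ⊗[A] Λᵐᵒᵖ, azumayaMulMap A Λ ((1 ⊗ₜ[A] MulOpposite.op x) * e) y =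
      azumayaMulMap A Λ e y * x := by
    intro e
    induction e with
    | zero => simp
    | add a b ha hb => simp only [mul_add, add_mul, map_add, LinearMap.add_apply, ha, hb]
    | tmul a b => simp [mul_assoc]
  rw [h1, h2, he]
  exact (Algebra.commutes _ _).symm

/-- If the multiplication map of `Λ` is surjective, an algebra map from `R ⊗ Λ` which is injective
on scalars is injective. -/
lemma injective_of_injective_algebraMap [Module.Finite A Λ] [Module.Projective A Λ]
    (hAz : Function.Surjective (azumayaMulMap A Λ)) {R S : Type*} [CommRing R] [Algebra A R]
    [Ring S] [Algebra R S] (hS : Function.Injective (algebraMap R S)) (φ : R ⊗[A] Λ →ₐ[R] S) :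
    Function.Injective φ := by
  have key (t : Λ →ₗ[A] A) (x : R ⊗[A] Λ) (hx : φ x = 0) : t.lTensor R x = 0 := by
    obtain ⟨e, he⟩ := hAz (Algebra.linearMap A Λ ∘ₗ t)
    have h0 (e : Λ ⊗[A] Λᵐᵒᵖ) : φ ((azumayaMulMap A Λ e).lTensor R x) = 0 := by
      induction e with
      | zero => simp
      | add a b ha hb => simp [LinearMap.lTensor_add, ha, hb]
      | tmul a b =>
        have : (azumayaMulMap A Λ (a ⊗ₜ b)).lTensor R x = (1 ⊗ₜ a) * x * (1 ⊗ₜ b.unop) := by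
          clear hx
          induction x with
          | zero => simp
          | add x y hx hy => simp only [map_add, mul_add, add_mul, hx, hy]
          | tmul r l => simp
        rw [this, map_mul, map_mul, hx]; simp
    have h1 := h0 e
    rw [he, LinearMap.lTensor_comp, LinearMap.comp_apply] at h1
    have h2 (y : R ⊗[A] A) : φ ((Algebra.linearMap A Λ).lTensor R y) =
        algebraMap R S (TensorProduct.rid A R y) := by
      induction y with
      | zero => simp
      | add x y hx hy => simp only [map_add, hx, hy]
      | tmul r a =>
        rw [LinearMap.lTensor_tmul, TensorProduct.rid_tmul, Algebra.linearMap_apply,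
          Algebra.algebraMap_eq_smul_one, ← TensorProduct.smul_tmul, ← AlgHom.commutes φ]
        rfl
    rw [h2] at h1
    exact (TensorProduct.rid A R).map_eq_zero_iff.mp ((map_eq_zero_iff _ hS).mp h1)
  obtain ⟨m, f, g, -, -, hfg⟩ := Module.Finite.exists_comp_eq_id_of_projective A Λ
  rw [injective_iff_map_eq_zero]
  intro x hx
  have hid : x = ∑ k, (f ∘ₗ LinearMap.single A _ k).lTensor R
      ((LinearMap.proj k ∘ₗ g).lTensor R x) := by
    have : (LinearMap.id : Λ →ₗ[A] Λ) =
        ∑ k, (f ∘ₗ LinearMap.single A _ k) ∘ₗ (LinearMap.proj k ∘ₗ g) := by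
      ext l
      conv_lhs => rw [← hfg]
      simp [← map_sum, Finset.univ_sum_single]
    conv_lhs => rw [← LinearMap.id_apply (R := A) x, ← LinearMap.lTensor_id, this]
    rw [← LinearMap.coe_lTensorHom, map_sum]
    simp [LinearMap.lTensor_comp]
  rw [hid]
  exact Finset.sum_eq_zero fun k _ ↦ by rw [key _ x hx, map_zero]

end Separability

section Lifting

variable {A Λ : Type u} {S : Type*} [CommRing A] [Ring Λ] [Algebra A Λ] [Ring S] [Algebra A S]

/-- The Hochschild cochain `y ↦ ∑ f aᵢ * (f (bᵢ y) - f bᵢ * f y)` attached to a linear map `f`,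
as a linear function of the tensor `∑ aᵢ ⊗ bᵢ`. -/
noncomputable def defectContraction (f : Λ →ₗ[A] S) (y : Λ) : Λ ⊗[A] Λᵐᵒᵖ →ₗ[A] S :=
  TensorProduct.lift <| (LinearMap.mul A S).compl₁₂ f <|
    (f ∘ₗ LinearMap.mulRight A y - LinearMap.mulRight A (f y) ∘ₗ f) ∘ₗ
      (MulOpposite.opLinearEquiv A).symm.toLinearMap

@[simp]
lemma defectContraction_tmul (f : Λ →ₗ[A] S) (y a : Λ) (b : Λᵐᵒᵖ) :
    defectContraction f y (a ⊗ₜ b) = f a * (f (b.unop * y) - f b.unop * f y) := by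
  simp [defectContraction]

/-- Algebra maps from an algebra with a separability element lift along surjections with
square-zero kernel. -/
lemma exists_algHom_lift_of_separability_element [Module.Projective A Λ] {S' : Type*}
    [Ring S'] [Algebra A S']
    {e : Λ ⊗[A] Λᵐᵒᵖ} (he : azumayaMulMap A Λ e 1 = 1)
    (hcomm : ∀ x : Λ, (x ⊗ₜ[A] (1 : Λᵐᵒᵖ)) * e = (1 ⊗ₜ MulOpposite.op x) * e)
    (π : S →ₐ[A] S') (hπ : Function.Surjective π)
    (hsq : ∀ x y, π x = 0 → π y = 0 → x * y = 0) (φ : Λ →ₐ[A] S') :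
    ∃ g : Λ →ₐ[A] S, π.comp g = φ := by
  obtain ⟨f, hf⟩ := Module.projective_lifting_property π.toLinearMap φ.toLinearMap hπ
  replace hf (x : Λ) : π (f x) = φ x := congr($hf x)
  have hker (x y : Λ) : π (f (x * y) - f x * f y) = 0 := by simp [hf]
  have hT (y : Λ) (e : Λ ⊗[A] Λᵐᵒᵖ) : π (defectContraction f y e) = 0 := by
    induction e with
    | zero => simp
    | add a b ha hb => simp [ha, hb]
    | tmul a b => rw [defectContraction_tmul, map_mul, hker, mul_zero]
  have hleft (x y : Λ) (e : Λ ⊗[A] Λᵐᵒᵖ) :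
      f x * defectContraction f y e = defectContraction f y ((x ⊗ₜ 1) * e) := by
    induction e with
    | zero => simp
    | add a b ha hb => simp [ha, hb, mul_add]
    | tmul a b =>
      have := hsq _ _ (hker x a) (hker b.unop y)
      simp only [Algebra.TensorProduct.tmul_mul_tmul, defectContraction_tmul, one_mul]
      rw [sub_mul, sub_eq_zero] at this
      rw [this, mul_assoc]
  have hright (x y : Λ) (e : Λ ⊗[A] Λᵐᵒᵖ) :
      defectContraction f (x * y) e - defectContraction f x e * f y =
        defectContraction f y ((1 ⊗ₜ MulOpposite.op x) * e) -
          f (azumayaMulMap A Λ e 1) * (f (x * y) - f x * f y) := by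
    induction e with
    | zero => simp
    | add a b ha hb =>
      simp only [map_add, add_mul, mul_add, LinearMap.add_apply]
      rw [add_sub_add_comm, ha, hb]
      abel
    | tmul a b =>
      have := hsq _ _ (hker a b.unop) (hker x y)
      rw [sub_mul, sub_eq_zero] at this
      simp only [Algebra.TensorProduct.tmul_mul_tmul, defectContraction_tmul, one_mul,
        azumayaMulMap_tmul, mul_one, this, MulOpposite.unop_mul, MulOpposite.unop_op, mul_assoc]
      noncomm_ring
  have hzero (e : Λ ⊗[A] Λᵐᵒᵖ) (x y : Λ) :
      defectContraction f (x + y) e = defectContraction f x e + defectContraction f y e := by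
    induction e with
    | zero => simp
    | add a b ha hb => simp only [map_add, ha, hb]; abel
    | tmul a b => simp only [defectContraction_tmul, map_add, mul_add]; noncomm_ring
  have hsmul (e : Λ ⊗[A] Λᵐᵒᵖ) (r : A) (x : Λ) :
      defectContraction f (r • x) e = r • defectContraction f x e := by
    induction e with
    | zero => simp
    | add a b ha hb => simp only [map_add, ha, hb, smul_add]
    | tmul a b => simp only [defectContraction_tmul, map_smul, mul_smul_comm, smul_sub, mul_sub]
  let g : Λ →ₗ[A] S :=
    { toFun y := f y + defectContraction f y e
      map_add' x y := by rw [hzero, map_add]; abel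
      map_smul' r x := by simp [hsmul] }
  have hg (x : Λ) : g x = f x + defectContraction f x e := rfl
  have hπg (x : Λ) : π (g x) = φ x := by simp [hg, hf, hT]
  have hmul (x y : Λ) : g (x * y) = g x * g y := by
    have h1 : (f 1 - 1) * (f (x * y) - f x * f y) = 0 := hsq _ _ (by simp [hf]) (hker x y)
    have h2 := hright x y e
    rw [← hcomm, ← hleft, he] at h2
    have h3 := hsq _ _ (hT x e) (hT y e)
    rw [sub_mul, one_mul, sub_eq_zero] at h1
    rw [h1] at h2
    simp only [hg, mul_add, add_mul, h3]
    rw [sub_eq_iff_eq_add] at h2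
    rw [h2]
    abel
  have hone : g 1 = 1 := by
    have h1 : (g 1 - 1) * (g 1 - 1) = 0 := hsq _ _ (by simp [hπg]) (by simp [hπg])
    have h2 : g 1 * g 1 = g 1 := by rw [← hmul, one_mul]
    have h3 : (g 1 - 1) * (g 1 - 1) = 1 - g 1 := by
      rw [sub_mul, mul_sub, h2]; simp
    rw [h3, sub_eq_zero] at h1
    exact h1.symm
  exact ⟨AlgHom.ofLinearMap g hone hmul, AlgHom.ext hπg⟩

end Lifting

section Universal

variable {A : Type u} (Λ : Type u) [CommRing A] [Ring Λ] [Algebra A Λ]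

/-- The functor of `n`-dimensional matrix representations of a finite projective algebra is
represented by a finitely presented commutative algebra. -/
lemma exists_universal_matrix_representation [Module.Finite A Λ] [Module.Projective A Λ] (n : ℕ) :
    ∃ (B : Type u) (_ : CommRing B) (_ : Algebra A B) (Φ : Λ →ₐ[A] Matrix (Fin n) (Fin n) B),
      Algebra.FinitePresentation A B ∧
      ∀ (R : Type u) [CommRing R] [Algebra A R] (φ : Λ →ₐ[A] Matrix (Fin n) (Fin n) R),
        ∃! h : B →ₐ[A] R, h.mapMatrix.comp Φ = φ := by
  obtain ⟨m, f, g, hsurj, -, hfg⟩ := Module.Finite.exists_comp_eq_id_of_projective A Λ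
  let s (k : Fin m) : Λ := f (Pi.single k 1)
  have hext {M : Type u} [AddCommGroup M] [Module A M] {p q : Λ →ₗ[A] M}
      (h : ∀ k, p (s k) = q (s k)) : p = q := by
    rw [← LinearMap.cancel_right hsurj]
    refine (Pi.basisFun A (Fin m)).ext fun k ↦ ?_
    simpa using h k
  have hrepr (l : Λ) : ∑ k, g l k • s k = l := by
    conv_rhs => rw [← LinearMap.id_apply (R := A) l, ← hfg, LinearMap.comp_apply,
      ← (Pi.basisFun A (Fin m)).sum_repr (g l), map_sum]
    simp [s]
  let P := MvPolynomial (Fin m × Fin n × Fin n) A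
  let X (k : Fin m) : Matrix (Fin n) (Fin n) P := Matrix.of fun i j ↦ MvPolynomial.X (k, i, j)
  let L : Λ →ₗ[A] Matrix (Fin n) (Fin n) P :=
    ∑ k, LinearMap.toSpanSingleton A _ (X k) ∘ₗ LinearMap.proj k ∘ₗ g
  have hL (l : Λ) : L l = ∑ k, g l k • X k := by simp [L]
  let r₁ (t : Fin m × Fin n × Fin n) : P := (L (s t.1) - X t.1) t.2.1 t.2.2
  let r₂ (t : Fin m × Fin m × Fin n × Fin n) : P :=
    (L (s t.1 * s t.2.1) - L (s t.1) * L (s t.2.1)) t.2.2.1 t.2.2.2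
  let r₃ (t : Fin n × Fin n) : P := (L 1 - 1) t.1 t.2
  let I : Ideal P := Ideal.span (Set.range r₁ ∪ Set.range r₂ ∪ Set.range r₃)
  have hI : I.FG := Submodule.fg_span
    (((Set.finite_range r₁).union (Set.finite_range r₂)).union (Set.finite_range r₃))
  let q : P →ₐ[A] P ⧸ I := Ideal.Quotient.mkₐ A I
  have hq (x : P) (hx : x ∈ I) : q x = 0 := Ideal.Quotient.eq_zero_iff_mem.mpr hx
  have h₁ (k) : q.mapMatrix (L (s k)) = q.mapMatrix (X k) := by
    rw [← sub_eq_zero, ← map_sub]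
    ext i j
    exact hq _ (Ideal.subset_span (.inl (.inl ⟨(k, i, j), rfl⟩)))
  have h₂ (k l) : q.mapMatrix (L (s k * s l)) = q.mapMatrix (L (s k)) * q.mapMatrix (L (s l)) := by
    rw [← map_mul q.mapMatrix, ← sub_eq_zero, ← map_sub]
    ext i j
    exact hq _ (Ideal.subset_span (.inl (.inr ⟨(k, l, i, j), rfl⟩)))
  have h₃ : q.mapMatrix (L 1) = 1 := by
    rw [← map_one q.mapMatrix, ← sub_eq_zero, ← map_sub]
    ext i j
    exact hq _ (Ideal.subset_span (.inr ⟨(i, j), rfl⟩))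
  let Q : Λ →ₗ[A] Matrix (Fin n) (Fin n) (P ⧸ I) := q.mapMatrix.toLinearMap ∘ₗ L
  have hmul : (LinearMap.mul A Λ).compr₂ Q = (LinearMap.mul A _).compl₁₂ Q Q :=
    hext fun k ↦ hext fun l ↦ h₂ k l
  let Φ : Λ →ₐ[A] Matrix (Fin n) (Fin n) (P ⧸ I) :=
    AlgHom.ofLinearMap Q h₃ fun x y ↦ by simpa using congr($hmul x y)
  have hΦ (k i j) : Φ (s k) i j = q (MvPolynomial.X (k, i, j)) := congr($(h₁ k) i j)
  refine ⟨P ⧸ I, inferInstance, inferInstance, Φ, .quotient hI, fun R _ _ φ ↦ ?_⟩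
  let h₀ : P →ₐ[A] R := MvPolynomial.aeval fun t ↦ φ (s t.1) t.2.1 t.2.2
  have hX (k) : h₀.mapMatrix (X k) = φ (s k) := by
    ext i j
    exact MvPolynomial.aeval_X _ (k, i, j)
  have hL' (l) : h₀.mapMatrix (L l) = φ l := by
    rw [hL, map_sum]
    simp_rw [map_smul, hX]
    rw [← congrArg φ (hrepr l), map_sum]
    simp_rw [map_smul]
  have hker : I ≤ RingHom.ker h₀ := by
    rw [Ideal.span_le]
    rintro _ ((⟨⟨k, i, j⟩, rfl⟩ | ⟨⟨k, l, i, j⟩, rfl⟩) | ⟨⟨i, j⟩, rfl⟩)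
    · change h₀.mapMatrix (L (s k) - X k) i j = 0
      simp [map_sub, hL', hX, -AlgHom.mapMatrix_apply]
    · change h₀.mapMatrix (L (s k * s l) - L (s k) * L (s l)) i j = 0
      simp [map_sub, hL', -AlgHom.mapMatrix_apply]
    · change h₀.mapMatrix (L 1 - 1) i j = 0
      simp [map_sub, hL', -AlgHom.mapMatrix_apply]
  refine ⟨Ideal.Quotient.liftₐ I h₀ hker, AlgHom.ext fun l ↦ ?_, fun h hh ↦ ?_⟩
  · rw [← hL' l]
    ext i j
    rfl
  · refine Ideal.Quotient.algHom_ext _ (MvPolynomial.algHom_ext fun t ↦ ?_)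
    have := congr($hh (s t.1) t.2.1 t.2.2)
    simp only [AlgHom.comp_apply, AlgHom.mapMatrix_apply, Matrix.map_apply, hΦ] at this
    have hX₀ : h₀ (.X t) = φ (s t.1) t.2.1 t.2.2 := MvPolynomial.aeval_X _ t
    exact this.trans hX₀.symm

end Universal

section Representation

variable {A Λ : Type u} [CommRing A] [Ring Λ] [Algebra A Λ]

lemma formallySmooth_of_universal_matrix_representation {n : ℕ} {e : Λ ⊗[A] Λᵐᵒᵖ}
    [Module.Projective A Λ] (he : azumayaMulMap A Λ e 1 = 1)
    (hcomm : ∀ x : Λ, (x ⊗ₜ[A] (1 : Λᵐᵒᵖ)) * e = (1 ⊗ₜ MulOpposite.op x) * e)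
    {B : Type u} [CommRing B] [Algebra A B] {Φ : Λ →ₐ[A] Matrix (Fin n) (Fin n) B}
    (hΦ : ∀ (R : Type u) [CommRing R] [Algebra A R] (φ : Λ →ₐ[A] Matrix (Fin n) (Fin n) R),
      ∃! h : B →ₐ[A] R, h.mapMatrix.comp Φ = φ) :
    Algebra.FormallySmooth A B := by
  refine Algebra.FormallySmooth.iff_comp_surjective.mpr fun R _ _ I hI f ↦ ?_
  let π : Matrix (Fin n) (Fin n) R →ₐ[A] Matrix (Fin n) (Fin n) (R ⧸ I) :=
    (Ideal.Quotient.mkₐ A I).mapMatrix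
  have hπ : Function.Surjective π := fun Y ↦
    ⟨Matrix.of fun i j ↦ (Ideal.Quotient.mk_surjective (Y i j)).choose, by
      ext i j
      exact (Ideal.Quotient.mk_surjective (Y i j)).choose_spec⟩
  have hmem (Y) (hY : π Y = 0) (i j) : Y i j ∈ I :=
    Ideal.Quotient.eq_zero_iff_mem.mp congr($hY i j)
  obtain ⟨g, hg⟩ := exists_algHom_lift_of_separability_element he hcomm π hπ
    (fun Y Z hY hZ ↦ by
      ext i j
      rw [Matrix.mul_apply, Matrix.zero_apply]
      refine Finset.sum_eq_zero fun k _ ↦ ?_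
      rw [← Ideal.mem_bot, ← hI, pow_two]
      exact Ideal.mul_mem_mul (hmem Y hY i k) (hmem Z hZ k j)) (f.mapMatrix.comp Φ)
  obtain ⟨h, hh, -⟩ := hΦ R g
  refine ⟨h, (hΦ _ (f.mapMatrix.comp Φ)).unique ?_ rfl⟩
  rw [← hg, ← hh]
  rfl

/-- Over an algebraically closed field an Azumaya algebra becomes a matrix algebra. -/
lemma exists_algEquiv_matrix_of_isAlgClosed [Module.Finite A Λ] [Module.Projective A Λ]
    [FaithfulSMul A Λ] (hAz : Function.Bijective (azumayaMulMap A Λ))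
    (k : Type u) [Field k] [IsAlgClosed k] [Algebra A k] :
    ∃ (d : ℕ) (_ : NeZero d), Nonempty (k ⊗[A] Λ ≃ₐ[k] Matrix (Fin d) (Fin d) k) := by
  obtain ⟨t, ht⟩ := exists_linearMap_apply_one_eq_one (A := A) (Λ := Λ)
  have hnt : Nontrivial (k ⊗[A] Λ) := by
    refine ⟨1, 0, fun h ↦ one_ne_zero (α := k) ?_⟩
    simpa [Algebra.TensorProduct.one_def, ht] using
      congrArg (TensorProduct.rid A k ∘ t.lTensor k) h
  have : IsSimpleRing (k ⊗[A] Λ) := by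
    refine isSimpleRing_iff_isTwoSided_imp.mpr
      ⟨hnt, fun I _ ↦ or_iff_not_imp_right.mpr fun hI ↦ ?_⟩
    have : Nontrivial ((k ⊗[A] Λ) ⧸ I) := Ideal.Quotient.nontrivial_iff.mpr hI
    have hinj := injective_of_injective_algebraMap hAz.2
      (FaithfulSMul.algebraMap_injective k ((k ⊗[A] Λ) ⧸ I)) (Ideal.Quotient.mkₐ k I)
    rw [eq_bot_iff]
    intro x hx
    exact hinj (by simpa using Ideal.Quotient.eq_zero_iff_mem.mpr hx)
  exact IsSimpleRing.exists_algEquiv_matrix_of_isAlgClosed k _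

lemma finrank_tensorProduct_eq_rankAtStalk [Module.Finite A Λ] [Module.Projective A Λ]
    (k : Type u) [Field k] [Algebra A k] :
    Module.finrank k (k ⊗[A] Λ) = Module.rankAtStalk Λ (PrimeSpectrum.comap (algebraMap A k) ⊥) := by
  rw [← Module.rankAtStalk_baseChange, Module.rankAtStalk_eq_finrank_of_free]
  rfl

lemma exists_isAlgClosed_comap_bot_eq (p : PrimeSpectrum A) :
    ∃ (k : Type u) (_ : Field k) (_ : Algebra A k), IsAlgClosed k ∧
      PrimeSpectrum.comap (algebraMap A k) ⊥ = p := by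
  refine ⟨AlgebraicClosure p.asIdeal.ResidueField, inferInstance, inferInstance, inferInstance, ?_⟩
  ext x
  change algebraMap A (AlgebraicClosure p.asIdeal.ResidueField) x = 0 ↔ _
  rw [IsScalarTower.algebraMap_apply A p.asIdeal.ResidueField, map_eq_zero,
    Ideal.algebraMap_residueField_eq_zero]

lemma preconnectedSpace_primeSpectrum (hconn : ∀ e : A, e * e = e → e = 0 ∨ e = 1) :
    PreconnectedSpace (PrimeSpectrum A) := by
  rw [preconnectedSpace_iff_clopen]
  intro s hs
  obtain ⟨e, he, rfl⟩ := PrimeSpectrum.exists_idempotent_basicOpen_eq_of_isClopen hs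
  rcases hconn e he with rfl | rfl <;> simp

/-- An Azumaya algebra over a connected ring has constant square rank. -/
lemma exists_rankAtStalk_eq_sq [Nontrivial A] [Module.Finite A Λ] [Module.Projective A Λ]
    [FaithfulSMul A Λ] (hconn : ∀ e : A, e * e = e → e = 0 ∨ e = 1)
    (hAz : Function.Bijective (azumayaMulMap A Λ)) :
    ∃ n : ℕ, 1 ≤ n ∧ ∀ p : PrimeSpectrum A, Module.rankAtStalk Λ p = n * n := by
  have := preconnectedSpace_primeSpectrum hconn
  obtain ⟨p₀⟩ : Nonempty (PrimeSpectrum A) := inferInstance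
  obtain ⟨k, _, _, _, hk⟩ := exists_isAlgClosed_comap_bot_eq p₀
  obtain ⟨n, hn, ⟨e⟩⟩ := exists_algEquiv_matrix_of_isAlgClosed hAz k
  have : Module.FinitePresentation A Λ := Module.finitePresentation_of_projective A Λ
  refine ⟨n, Nat.one_le_iff_ne_zero.mpr hn.out, fun p ↦ ?_⟩
  rw [(Module.isLocallyConstant_rankAtStalk (R := A) (M := Λ)).apply_eq_of_preconnectedSpace p p₀,
    ← hk, ← finrank_tensorProduct_eq_rankAtStalk, e.toLinearEquiv.finrank_eq,
    Module.finrank_matrix]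
  simp

/-- The `R`-linear extension of a matrix representation. -/
noncomputable def matrixRepresentationBaseChange {n : ℕ} {R : Type u} [CommRing R] [Algebra A R]
    (Φ : Λ →ₐ[A] Matrix (Fin n) (Fin n) R) : R ⊗[A] Λ →ₐ[R] Matrix (Fin n) (Fin n) R :=
  Algebra.TensorProduct.lift (Algebra.ofId R _) Φ fun _ _ ↦ Algebra.commutes _ _

@[simp]
lemma matrixRepresentationBaseChange_tmul {n : ℕ} {R : Type u} [CommRing R] [Algebra A R]
    (Φ : Λ →ₐ[A] Matrix (Fin n) (Fin n) R) (r : R) (l : Λ) :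
    matrixRepresentationBaseChange Φ (r ⊗ₜ l) = r • Φ l :=
  (Algebra.TensorProduct.lift_tmul _ _ _ _ _).trans (Algebra.smul_def _ _).symm

/-- A submodule containing a given one modulo every maximal ideal is everything. -/
lemma submodule_eq_top_of_forall_isMaximal {R M : Type*} [CommRing R] [AddCommGroup M] [Module R M]
    [Module.Finite R M] (N : Submodule R M)
    (h : ∀ I : Ideal R, I.IsMaximal → N ⊔ I • (⊤ : Submodule R M) = ⊤) : N = ⊤ := by
  by_contra hN
  obtain ⟨N', hN', hle⟩ := (eq_top_or_exists_le_coatom N).resolve_left hN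
  have : IsSimpleModule R (M ⧸ N') := isSimpleModule_iff_isCoatom.mpr hN'
  obtain ⟨I, hI, ⟨e⟩⟩ := isSimpleModule_iff_quot_maximal.mp this
  refine hN'.1 (top_le_iff.mp ((h I hI).ge.trans
    (sup_le hle (Submodule.smul_le.mpr fun r hr x _ ↦ ?_))))
  rw [← Submodule.Quotient.mk_eq_zero, ← e.map_eq_zero_iff, Submodule.Quotient.mk_smul, map_smul]
  obtain ⟨y, hy⟩ := Ideal.Quotient.mk_surjective (e (Submodule.Quotient.mk x))
  rw [← hy]
  exact Ideal.Quotient.eq_zero_iff_mem.mpr (I.mul_mem_right y hr)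

lemma bijective_matrixRepresentationBaseChange [Module.Finite A Λ] [Module.Projective A Λ]
    (hAz : Function.Surjective (azumayaMulMap A Λ)) {n : ℕ} (hn : 1 ≤ n)
    (hrank : ∀ p : PrimeSpectrum A, Module.rankAtStalk Λ p = n * n)
    {R : Type u} [CommRing R] [Algebra A R] (Φ : Λ →ₐ[A] Matrix (Fin n) (Fin n) R) :
    Function.Bijective (matrixRepresentationBaseChange Φ) := by
  have hinj {K : Type u} [CommRing K] [Algebra A K] (Ψ : Λ →ₐ[A] Matrix (Fin n) (Fin n) K) :
      Function.Injective (matrixRepresentationBaseChange Ψ) :=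
    injective_of_injective_algebraMap hAz (fun a b h ↦ by
      simpa [Matrix.algebraMap_matrix_apply] using congr($h ⟨0, hn⟩ ⟨0, hn⟩)) _
  refine ⟨hinj Φ, ?_⟩
  rw [← AlgHom.coe_toLinearMap, ← LinearMap.range_eq_top]
  refine submodule_eq_top_of_forall_isMaximal _ fun I hI ↦ ?_
  let _ : Field (R ⧸ I) := Ideal.Quotient.field I
  let π := Ideal.Quotient.mkₐ A I
  let Ψ := π.mapMatrix.comp Φ
  have hsurj : Function.Surjective (matrixRepresentationBaseChange Ψ) := by
    refine (LinearMap.injective_iff_surjective_of_finrank_eq_finrank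
      (f := (matrixRepresentationBaseChange Ψ).toLinearMap) ?_).mp (hinj Ψ)
    rw [finrank_tensorProduct_eq_rankAtStalk, hrank, Module.finrank_matrix]
    simp
  have hlift (w : (R ⧸ I) ⊗[A] Λ) : ∃ z, π.mapMatrix (matrixRepresentationBaseChange Φ z) =
      matrixRepresentationBaseChange Ψ w := by
    induction w with
    | zero => exact ⟨0, by simp only [map_zero]⟩
    | add a b ha hb =>
      obtain ⟨x, hx⟩ := ha
      obtain ⟨y, hy⟩ := hb
      exact ⟨x + y, by simp only [map_add, hx, hy]⟩
    | tmul c l =>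
      obtain ⟨r, rfl⟩ := Ideal.Quotient.mk_surjective c
      refine ⟨r ⊗ₜ l, ?_⟩
      ext i j
      simp [Ψ, π]
  rw [eq_top_iff]
  intro Y _
  obtain ⟨w, hw⟩ := hsurj (π.mapMatrix Y)
  obtain ⟨z, hz⟩ := hlift w
  rw [← add_sub_cancel (matrixRepresentationBaseChange Φ z) Y]
  refine Submodule.add_mem_sup ⟨z, rfl⟩ ?_
  rw [Matrix.matrix_eq_sum_single (Y - _)]
  refine Submodule.sum_mem _ fun i _ ↦ Submodule.sum_mem _ fun j _ ↦ ?_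
  rw [← mul_one ((Y - matrixRepresentationBaseChange Φ z) i j), ← smul_eq_mul, ← Matrix.smul_single]
  refine Submodule.smul_mem_smul (Ideal.Quotient.eq_zero_iff_mem.mp ?_) trivial
  have := congr($(hz.trans hw) i j)
  rw [Matrix.sub_apply, map_sub, sub_eq_zero]
  exact this.symm

/-- The algebra representing the matrix representations of an Azumaya algebra, in the dimension
given by its rank, is faithfully flat. -/
lemma faithfullyFlat_of_universal_matrix_representation [Module.Finite A Λ] [Module.Projective A Λ]
    [FaithfulSMul A Λ] (hAz : Function.Bijective (azumayaMulMap A Λ)) {n : ℕ}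
    (hrank : ∀ p : PrimeSpectrum A, Module.rankAtStalk Λ p = n * n)
    {B : Type u} [CommRing B] [Algebra A B] [Algebra.FinitePresentation A B]
    {Φ : Λ →ₐ[A] Matrix (Fin n) (Fin n) B}
    (hΦ : ∀ (R : Type u) [CommRing R] [Algebra A R] (φ : Λ →ₐ[A] Matrix (Fin n) (Fin n) R),
      ∃! h : B →ₐ[A] R, h.mapMatrix.comp Φ = φ) :
    Module.FaithfullyFlat A B := by
  obtain ⟨e, he, hcomm⟩ := exists_separability_element hAz
  have := formallySmooth_of_universal_matrix_representation he hcomm hΦ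
  have : Algebra.Smooth A B := ⟨inferInstance, inferInstance⟩
  refine .of_comap_surjective fun p ↦ ?_
  obtain ⟨k, _, _, _, rfl⟩ := exists_isAlgClosed_comap_bot_eq p
  obtain ⟨d, _, ⟨e⟩⟩ := exists_algEquiv_matrix_of_isAlgClosed hAz k
  obtain rfl : d = n := by
    have := hrank (PrimeSpectrum.comap (algebraMap A k) ⊥)
    rw [← finrank_tensorProduct_eq_rankAtStalk, e.toLinearEquiv.finrank_eq,
      Module.finrank_matrix] at this
    exact Nat.mul_self_inj.mp (by simpa using this)
  obtain ⟨h, -⟩ := hΦ k ((e.toAlgHom.restrictScalars A).comp Algebra.TensorProduct.includeRight)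
  refine ⟨PrimeSpectrum.comap h.toRingHom ⊥, ?_⟩
  rw [← PrimeSpectrum.comap_comp_apply]
  congr 1
  exact h.comp_algebraMap

end Representation

section Derivation

variable {A Λ : Type u} [CommRing A] [Ring Λ] [Algebra A Λ]

/-- The universal matrix representation is universal for matrix representations that are
semilinear along a ring homomorphism. -/
lemma exists_ringHom_of_universal_matrix_representation {n : ℕ} {B : Type u} [CommRing B]
    [Algebra A B] {Φ : Λ →ₐ[A] Matrix (Fin n) (Fin n) B}
    (hΦ : ∀ (R : Type u) [CommRing R] [Algebra A R] (φ : Λ →ₐ[A] Matrix (Fin n) (Fin n) R),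
      ∃! h : B →ₐ[A] R, h.mapMatrix.comp Φ = φ)
    {R : Type u} [CommRing R] (c : A →+* R) (F : Λ →+* Matrix (Fin n) (Fin n) R)
    (hF : ∀ a, F (algebraMap A Λ a) = Matrix.scalar _ (c a)) :
    ∃ h : B →+* R, (∀ a, h (algebraMap A B a) = c a) ∧ ∀ l, (Φ l).map h = F l := by
  let _ := c.toAlgebra
  let φ : Λ →ₐ[A] Matrix (Fin n) (Fin n) R := { F with commutes' := hF }
  obtain ⟨h, hh, -⟩ := hΦ R φ
  exact ⟨h, h.commutes, fun l ↦ DFunLike.congr_fun hh l⟩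

/-- The universal matrix representation of an algebra with derivation is differential for some
derivation on the representing algebra. -/
lemma exists_derivation_of_universal_matrix_representation {n : ℕ} {B : Type u} [CommRing B]
    [Algebra A B] {Φ : Λ →ₐ[A] Matrix (Fin n) (Fin n) B}
    (hΦ : ∀ (R : Type u) [CommRing R] [Algebra A R] (φ : Λ →ₐ[A] Matrix (Fin n) (Fin n) R),
      ∃! h : B →ₐ[A] R, h.mapMatrix.comp Φ = φ)
    (δ : A → A) (hδadd : ∀ a b : A, δ (a + b) = δ a + δ b)
    (hδmul : ∀ a b : A, δ (a * b) = δ a * b + a * δ b)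
    (D : Λ → Λ) (hDadd : ∀ x y : Λ, D (x + y) = D x + D y)
    (hDmul : ∀ x y : Λ, D (x * y) = D x * y + x * D y)
    (hDalg : ∀ a : A, D (algebraMap A Λ a) = algebraMap A Λ (δ a)) :
    ∃ δB : B → B, (∀ x y, δB (x + y) = δB x + δB y) ∧
      (∀ x y, δB (x * y) = δB x * y + x * δB y) ∧
      (∀ a, δB (algebraMap A B a) = algebraMap A B (δ a)) ∧
      ∀ l, (Φ l).map δB = Φ (D l) := by
  have hδ0 : δ 0 = 0 := by simpa using hδadd 0 0
  have hδ1 : δ 1 = 0 := by simpa using hδmul 1 1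
  have hD0 : D 0 = 0 := by simpa using hDadd 0 0
  have hD1 : D 1 = 0 := by simpa using hDmul 1 1
  let c : A →+* TrivSqZeroExt B B :=
    { toFun a := .inl (algebraMap A B a) + .inr (algebraMap A B (δ a))
      map_zero' := by simp [hδ0]
      map_one' := by simp [hδ1]
      map_add' a b := by
        rw [hδadd, map_add, map_add, TrivSqZeroExt.inl_add, TrivSqZeroExt.inr_add]
        abel
      map_mul' a b := by
        ext
        · simp
        · simp only [hδmul, map_add, map_mul, TrivSqZeroExt.snd_add, TrivSqZeroExt.snd_inl,
            TrivSqZeroExt.snd_inr, TrivSqZeroExt.snd_mul, TrivSqZeroExt.fst_add,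
            TrivSqZeroExt.fst_inl, TrivSqZeroExt.fst_inr, smul_eq_mul,
            MulOpposite.smul_eq_mul_unop, MulOpposite.unop_op]
          ring }
  let F : Λ →+* Matrix (Fin n) (Fin n) (TrivSqZeroExt B B) :=
    { toFun l := .of fun i j ↦ .inl (Φ l i j) + .inr (Φ (D l) i j)
      map_zero' := by ext i j <;> simp [hD0]
      map_one' := by
        ext i j <;> by_cases h : i = j <;> simp [hD1, Matrix.one_apply, h]
      map_add' a b := by ext i j <;> simp [hDadd]
      map_mul' a b := by
        ext i j
        · simp [Matrix.mul_apply, TrivSqZeroExt.fst_sum]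
        · simp [hDmul, Matrix.mul_apply, TrivSqZeroExt.snd_sum, Finset.sum_add_distrib,
            mul_comm, add_comm] }
  have hF (a : A) : F (algebraMap A Λ a) = Matrix.scalar _ (c a) := by
    ext i j <;> by_cases h : i = j <;>
      simp [F, c, hDalg, h, Matrix.algebraMap_matrix_apply]
  obtain ⟨h, hc, hhF⟩ := exists_ringHom_of_universal_matrix_representation hΦ c F hF
  let p : B →ₐ[A] B :=
    { (TrivSqZeroExt.fstHom B B B : TrivSqZeroExt B B →+* B).comp h with
      commutes' a := by simp [hc, c] }
  have hp : p = AlgHom.id A B := by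
    refine (hΦ B Φ).unique ?_ (by ext; simp)
    ext l i j
    simpa [p, F] using congr(TrivSqZeroExt.fst ($(hhF l) i j))
  have hfst (b : B) : (h b).fst = b := DFunLike.congr_fun hp b
  refine ⟨fun b ↦ (h b).snd, fun x y ↦ by simp, fun x y ↦ ?_, fun a ↦ ?_, fun l ↦ ?_⟩
  · simp [hfst, mul_comm, add_comm]
  · refine (congrArg _ (hc a)).trans ?_
    exact (TrivSqZeroExt.snd_add _ _).trans (zero_add _)
  · ext i j
    simpa [F] using congr(TrivSqZeroExt.snd ($(hhF l) i j))

end Derivation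

/-- Let `(A, δ)` be a connected differential ring (a ℚ-algebra with no
nontrivial idempotents) and let `Λ` be an Azumaya `A`-algebra with a derivation `D`
extending `δ`.  Then there are `n ≥ 1`, a faithfully flat differential extension
`(B, δ_B)`, and a `B`-algebra isomorphism `ψ : B ⊗[A] Λ ≃ Mₙ(B)` that is differential:
`ψ (D̃ t) = δ_B(ψ t)` (entrywise) for all `t`, where `D̃` is the unique additive map with
`D̃ (b ⊗ λ) = δ_B b ⊗ λ + b ⊗ D λ`. -/
theorem differential_azumaya_locally_trivial
    {A Λ : Type u} [CommRing A] [Algebra ℚ A] [Nontrivial A]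
    [Ring Λ] [Algebra A Λ]
    [Module.Finite A Λ] [Module.Projective A Λ] [FaithfulSMul A Λ]
    (hconn : ∀ e : A, e * e = e → e = 0 ∨ e = 1)
    (hAz : Function.Bijective (azumayaMulMap A Λ))
    (δ : A → A)
    (hδadd : ∀ a b : A, δ (a + b) = δ a + δ b)
    (hδmul : ∀ a b : A, δ (a * b) = δ a * b + a * δ b)
    (D : Λ → Λ)
    (hDadd : ∀ x y : Λ, D (x + y) = D x + D y)
    (hDmul : ∀ x y : Λ, D (x * y) = D x * y + x * D y)
    (hDalg : ∀ a : A, D (algebraMap A Λ a) = algebraMap A Λ (δ a)) :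
    ∃ (n : ℕ) (_ : 1 ≤ n) (E : FFDiffExt A δ)
      (ψ : (E.B ⊗[A] Λ) ≃ₐ[E.B] Matrix (Fin n) (Fin n) E.B),
      ∀ Dt : E.B ⊗[A] Λ → E.B ⊗[A] Λ,
        (∀ x y : E.B ⊗[A] Λ, Dt (x + y) = Dt x + Dt y) →
        (∀ (b : E.B) (l : Λ), Dt (b ⊗ₜ[A] l) = E.δB b ⊗ₜ[A] l + b ⊗ₜ[A] D l) →
        ∀ t : E.B ⊗[A] Λ, ψ (Dt t) = (ψ t).map E.δB := by
  obtain ⟨n, hn, hrank⟩ := exists_rankAtStalk_eq_sq hconn hAz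
  obtain ⟨B, _, _, Φ, _, hΦ⟩ := exists_universal_matrix_representation (A := A) Λ n
  obtain ⟨δB, hadd, hmul, hcompat, hδΦ⟩ := exists_derivation_of_universal_matrix_representation
    hΦ δ hδadd hδmul D hDadd hDmul hDalg
  refine ⟨n, hn, ⟨B, δB, hadd, hmul, hcompat,
    faithfullyFlat_of_universal_matrix_representation hAz hrank hΦ⟩,
    AlgEquiv.ofBijective (matrixRepresentationBaseChange Φ)
      (bijective_matrixRepresentationBaseChange hAz.2 hn hrank Φ), fun Dt hDt hDt' t ↦ ?_⟩
  dsimp only at Dt hDt hDt' t ⊢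
  rw [AlgEquiv.ofBijective_apply, AlgEquiv.ofBijective_apply]
  have hδ0 : δB 0 = 0 := by simpa using hadd 0 0
  induction t with
  | zero =>
    have hDt0 : Dt 0 = 0 := by simpa using hDt 0 0
    rw [hDt0, map_zero]
    ext i j
    simp [hδ0]
  | add x y hx hy =>
    rw [hDt, map_add, map_add, hx, hy]
    ext i j
    simp [hadd]
  | tmul b l =>
    rw [hDt', map_add, matrixRepresentationBaseChange_tmul, matrixRepresentationBaseChange_tmul,
      matrixRepresentationBaseChange_tmul, ← hδΦ]
    ext i j
    simp [hmul]
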